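/- Let G be a nonempty position. Then v(G) is given by the first of the following cases that applies: (1) if c(G) ≥ 2 then v(G) = c(G); (2) if c(G) = 0 and G contains a 4-loop and G is not the position consisting of one 4-loop and two 3-chains, then v(G) = 0; (3) if θ(G) = 0, or θ(G) = 1 and size(G) ≡ 3 (mod 4), then: (a) if c(G) + 4·f(G) ≥ 2 then v(G) = 0, 1, 2, 3, 4 according to whether c(G) ≡ 0, ±1, ±2, ±3, 4 (mod 8); (b) if c(G) + 4·f(G) < 2 then: if size(G) is odd then v(G) = 1 if f(G) is odd and v(G) = 3 if f(G) is even; if size(G) ≡ 2 (mod 4) then v(G) = 2; if size(G) ≡ 0 (mod 4) then v(G) = 0 if f(G) is odd and v(G) = 4 if f(G) is even; (4) in all other cases, v(G) = 1 if size(G) is odd and v(G) = 2 if size(G) is even. -/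

import Mathlib

namespace DotsAndBoxes

/-- A component of a Dots & Boxes endgame position: an `n`-chain or an `n`-loop. -/
inductive Component : Type where
  | chain (n : ℕ)
  | loop (n : ℕ)
deriving DecidableEq

namespace Component

/-- The number of boxes in a component. -/
def size : Component → ℕ
  | chain n => n
  | loop n => n

def isChain : Component → Bool
  | chain _ => true
  | loop _ => false

def isLoop : Component → Bool
  | chain _ => false
  | loop _ => true

/-- A chain must have length at least 3; a loop must have even length at least 4. -/
def Valid : Component → Prop
  | chain n => 3 ≤ n
  | loop n => 4 ≤ n ∧ Even n

end Component

/-- A position is a finite multiset of components. -/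
abbrev Position := Multiset Component

def Position.Valid (G : Position) : Prop := ∀ C ∈ G, C.Valid

/-- The number of unclaimed boxes in a position. -/
def size (G : Position) : ℕ := (G.map Component.size).sum

/-- The number of chains of a position. -/
def numChains (G : Position) : ℕ := Multiset.card (G.filter fun C => C.isChain = true)

/-- The number of loops of a position. -/
def numLoops (G : Position) : ℕ := Multiset.card (G.filter fun C => C.isLoop = true)

/-- θ(G), the number of 3-chains. -/
def theta (G : Position) : ℕ := G.count (Component.chain 3)

/-- f(G), the number of 4-loops. -/
def numF (G : Position) : ℕ := G.count (Component.loop 4)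

/-- s(G), the number of 6-loops. -/
def numS (G : Position) : ℕ := G.count (Component.loop 6)

open Classical in
/-- The terminal bonus tb(G). -/
noncomputable def tb (G : Position) : ℤ :=
  if G = 0 then 0
  else if ∀ C ∈ G, C.isLoop = true then 8
  else if (∃ C ∈ G, C.isLoop = true) ∧ Component.chain 3 ∈ G ∧
      (∀ C ∈ G, C.isChain = true → C = Component.chain 3) then 6
  else 4

/-- The controlled value c(G). -/
noncomputable def cval (G : Position) : ℤ :=
  (size G : ℤ) - 4 * (numChains G : ℤ) - 8 * (numLoops G : ℤ) + tb G

/-- The score v(G;C) of opening component `C`, given that the remainder of the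
position has value `w`. -/
def openVal (C : Component) (w : ℤ) : ℤ :=
  match C with
  | Component.chain n => ((n : ℤ) - 2) + |w - 2|
  | Component.loop n => ((n : ℤ) - 4) + |w - 4|

/-- Auxiliary recursion (on the number of components) for the value `v`. -/
noncomputable def valueAux : ℕ → Position → ℤ
  | 0, _ => 0
  | n + 1, G =>
    if G = 0 then 0
    else sInf { x : ℤ | ∃ C ∈ G, x = openVal C (valueAux n (G.erase C)) }

/-- The value v(G): v(∅) = 0, and v(G) = min over components C of G of v(G;C). -/
noncomputable def value (G : Position) : ℤ := valueAux (Multiset.card G) G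

/-- v(G;C), the value of G given that the opener has just opened C. -/
noncomputable def valueOpen (G : Position) (C : Component) : ℤ :=
  openVal C (value (G.erase C))

/-- Opening a component C of G is optimal if C ∈ G and v(G;C) = v(G). -/
def Optimal (G : Position) (C : Component) : Prop :=
  C ∈ G ∧ valueOpen G C = value G


/-- Case (1) of the explicit value theorem. -/
def ValCase1 (G : Position) : Prop := 2 ≤ cval G

/-- Case (2): c(G) = 0 and G contains a 4-loop and G is not one 4-loop plus two 3-chains. -/
def ValCase2 (G : Position) : Prop :=
  cval G = 0 ∧ Component.loop 4 ∈ G ∧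
    G ≠ Component.loop 4 ::ₘ Component.chain 3 ::ₘ {Component.chain 3}

/-- Case (3): θ(G) = 0, or θ(G) = 1 and size(G) ≡ 3 (mod 4). -/
def ValCase3 (G : Position) : Prop :=
  theta G = 0 ∨ (theta G = 1 ∧ size G % 4 = 3)

/-- The terminal bonus in terms of statistics. -/
def tbI (K L t : ℤ) : ℤ :=
  if K = 0 then (if L = 0 then 0 else 8) else if 0 < L ∧ K = t then 6 else 4

/-- The claimed value in terms of statistics and the controlled value `c`. -/
def W0 (c S K L t f : ℤ) : ℤ :=
  if 2 ≤ c then c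
  else if c = 0 ∧ 0 < f ∧ ¬ (S = 10 ∧ K = 2 ∧ L = 1 ∧ t = 2 ∧ f = 1) then 0
  else if t = 0 ∨ (t = 1 ∧ S % 4 = 3) then
    (if 2 ≤ c + 4 * f then (if c % 8 ≤ 4 then c % 8 else 8 - c % 8)
     else if S % 2 = 1 then (if f % 2 = 1 then 1 else 3)
     else if S % 4 = 2 then 2
     else if f % 2 = 1 then 0 else 4)
  else if S % 2 = 1 then 1 else 2

/-- The claimed value in terms of statistics. -/
def W (S K L t f : ℤ) : ℤ :=
  if K = 0 ∧ L = 0 then 0 else W0 (S - 4 * K - 8 * L + tbI K L t) S K L t f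

/-- Constraints satisfied by the statistics of a position. -/
def StatInv (S K L t f s : ℤ) : Prop :=
  0 ≤ t ∧ 0 ≤ f ∧ 0 ≤ s ∧ t ≤ K ∧ f + s ≤ L ∧
  3 * t + 4 * (K - t) + 4 * f + 6 * s + 8 * (L - f - s) ≤ S ∧
  (K = t → (S - t) % 2 = 0) ∧
  (K = t → L = f + s → S = 3 * t + 4 * f + 6 * s)

theorem tbI_cases (K L t : ℤ) (hK : 0 ≤ K) (hL : 0 ≤ L) :
    (K = 0 ∧ L = 0 ∧ tbI K L t = 0) ∨ (K = 0 ∧ 0 < L ∧ tbI K L t = 8) ∨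
    (0 < K ∧ 0 < L ∧ K = t ∧ tbI K L t = 6) ∨ (0 < K ∧ L = 0 ∧ tbI K L t = 4) ∨
    (0 < K ∧ 0 < L ∧ K ≠ t ∧ tbI K L t = 4) := by
  unfold tbI
  split_ifs <;> omega

theorem W0_cases (c S K L t f : ℤ) :
    (2 ≤ c ∧ W0 c S K L t f = c) ∨
    (c = 0 ∧ 0 < f ∧ ¬ (S = 10 ∧ K = 2 ∧ L = 1 ∧ t = 2 ∧ f = 1) ∧ W0 c S K L t f = 0) ∨
    (c < 2 ∧ (c = 0 → f ≤ 0) ∧ (t = 0 ∨ (t = 1 ∧ S % 4 = 3)) ∧ 2 ≤ c + 4 * f ∧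
      c % 8 ≤ 4 ∧ W0 c S K L t f = c % 8) ∨
    (c < 2 ∧ (c = 0 → f ≤ 0) ∧ (t = 0 ∨ (t = 1 ∧ S % 4 = 3)) ∧ 2 ≤ c + 4 * f ∧
      4 < c % 8 ∧ W0 c S K L t f = 8 - c % 8) ∨
    (c < 2 ∧ (t = 0 ∨ (t = 1 ∧ S % 4 = 3)) ∧ c + 4 * f < 2 ∧ S % 2 = 1 ∧ f % 2 = 1 ∧
      W0 c S K L t f = 1) ∨
    (c < 2 ∧ (t = 0 ∨ (t = 1 ∧ S % 4 = 3)) ∧ c + 4 * f < 2 ∧ S % 2 = 1 ∧ f % 2 = 0 ∧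
      W0 c S K L t f = 3) ∨
    (c < 2 ∧ t = 0 ∧ c + 4 * f < 2 ∧ S % 4 = 2 ∧ W0 c S K L t f = 2) ∨
    (c < 2 ∧ t = 0 ∧ c + 4 * f < 2 ∧ S % 4 = 0 ∧ f % 2 = 1 ∧ W0 c S K L t f = 0) ∨
    (c < 2 ∧ t = 0 ∧ c + 4 * f < 2 ∧ S % 4 = 0 ∧ f % 2 = 0 ∧ W0 c S K L t f = 4) ∨
    (c < 2 ∧ (c = 0 → f ≤ 0 ∨ (S = 10 ∧ K = 2 ∧ L = 1 ∧ t = 2 ∧ f = 1)) ∧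
      t ≠ 0 ∧ (t = 1 → S % 4 ≠ 3) ∧ S % 2 = 1 ∧ W0 c S K L t f = 1) ∨
    (c < 2 ∧ (c = 0 → f ≤ 0 ∨ (S = 10 ∧ K = 2 ∧ L = 1 ∧ t = 2 ∧ f = 1)) ∧
      t ≠ 0 ∧ (t = 1 → S % 4 ≠ 3) ∧ S % 2 = 0 ∧ W0 c S K L t f = 2) := by
  generalize hw : W0 c S K L t f = w
  unfold W0 at hw
  split_ifs at hw <;>
  first
  | (refine Or.inl ?_; and_intros <;> omega)
  | (refine Or.inr (Or.inl ?_); and_intros <;> omega)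
  | (refine Or.inr (Or.inr (Or.inl ?_)); and_intros <;> omega)
  | (refine Or.inr (Or.inr (Or.inr (Or.inl ?_))); and_intros <;> omega)
  | (refine Or.inr (Or.inr (Or.inr (Or.inr (Or.inl ?_)))); and_intros <;> omega)
  | (refine Or.inr (Or.inr (Or.inr (Or.inr (Or.inr (Or.inl ?_))))); and_intros <;> omega)
  | (refine Or.inr (Or.inr (Or.inr (Or.inr (Or.inr (Or.inr (Or.inl ?_)))))); and_intros <;> omega)
  | (refine Or.inr (Or.inr (Or.inr (Or.inr (Or.inr (Or.inr (Or.inr ?_))))))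
     first
     | (refine Or.inl ?_; and_intros <;> omega)
     | (refine Or.inr (Or.inl ?_); and_intros <;> omega)
     | (refine Or.inr (Or.inr (Or.inl ?_)); and_intros <;> omega)
     | (refine Or.inr (Or.inr (Or.inr ?_)); and_intros <;> omega))

theorem W_spec (S K L t f : ℤ) (hK : 0 ≤ K) (hL : 0 ≤ L) :
    (K = 0 ∧ L = 0 ∧ W S K L t f = 0) ∨
    (0 < K + L ∧ ∃ c, c = S - 4 * K - 8 * L + tbI K L t ∧ W S K L t f = W0 c S K L t f) := by
  unfold W
  split_ifs
  · omega
  · exact Or.inr ⟨by omega, _, rfl, rfl⟩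

theorem W0_nest (c S K L t f : ℤ) :
    ((2 ≤ c ∧ W0 c S K L t f = c) ∧ (Unit → True)) ∨
    ((c = 0 ∧ 0 < f ∧ ¬ (S = 10 ∧ K = 2 ∧ L = 1 ∧ t = 2 ∧ f = 1) ∧ W0 c S K L t f = 0) ∧
      (Unit → True)) ∨
    ((c < 2 ∧ (c = 0 → f ≤ 0) ∧ (t = 0 ∨ (t = 1 ∧ S % 4 = 3)) ∧ 2 ≤ c + 4 * f) ∧
      (Unit → (c % 8 ≤ 4 ∧ W0 c S K L t f = c % 8) ∨ (4 < c % 8 ∧ W0 c S K L t f = 8 - c % 8))) ∨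
    ((c < 2 ∧ (t = 0 ∨ (t = 1 ∧ S % 4 = 3)) ∧ c + 4 * f < 2) ∧
      (Unit → (S % 2 = 1 ∧ f % 2 = 1 ∧ W0 c S K L t f = 1) ∨
        (S % 2 = 1 ∧ f % 2 = 0 ∧ W0 c S K L t f = 3) ∨
        (t = 0 ∧ S % 4 = 2 ∧ W0 c S K L t f = 2) ∨
        (t = 0 ∧ S % 4 = 0 ∧ f % 2 = 1 ∧ W0 c S K L t f = 0) ∨
        (t = 0 ∧ S % 4 = 0 ∧ f % 2 = 0 ∧ W0 c S K L t f = 4))) ∨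
    ((c < 2 ∧ (c = 0 → f ≤ 0 ∨ (S = 10 ∧ K = 2 ∧ L = 1 ∧ t = 2 ∧ f = 1)) ∧
      t ≠ 0 ∧ (t = 1 → S % 4 ≠ 3)) ∧
      (Unit → (S % 2 = 1 ∧ W0 c S K L t f = 1) ∨ (S % 2 = 0 ∧ W0 c S K L t f = 2))) := by
  rcases W0_cases c S K L t f with h | h | ⟨a, b, d, e, g⟩ | ⟨a, b, d, e, g⟩ | ⟨a, b, d, g⟩ |
    ⟨a, b, d, g⟩ | ⟨a, b, d, g⟩ | ⟨a, b, d, g⟩ | ⟨a, b, d, g⟩ | ⟨a, b, d, e, g⟩ | ⟨a, b, d, e, g⟩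
  · exact Or.inl ⟨h, fun _ => trivial⟩
  · exact Or.inr (Or.inl ⟨h, fun _ => trivial⟩)
  · exact Or.inr (Or.inr (Or.inl ⟨⟨a, b, d, e⟩, fun _ => Or.inl g⟩))
  · exact Or.inr (Or.inr (Or.inl ⟨⟨a, b, d, e⟩, fun _ => Or.inr g⟩))
  · exact Or.inr (Or.inr (Or.inr (Or.inl ⟨⟨a, b, d⟩, fun _ => Or.inl g⟩)))
  · exact Or.inr (Or.inr (Or.inr (Or.inl ⟨⟨a, b, d⟩, fun _ => Or.inr (Or.inl g)⟩)))
  · exact Or.inr (Or.inr (Or.inr (Or.inl ⟨⟨a, Or.inl b, d⟩,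
      fun _ => Or.inr (Or.inr (Or.inl ⟨b, g⟩))⟩)))
  · exact Or.inr (Or.inr (Or.inr (Or.inl ⟨⟨a, Or.inl b, d⟩,
      fun _ => Or.inr (Or.inr (Or.inr (Or.inl ⟨b, g⟩)))⟩)))
  · exact Or.inr (Or.inr (Or.inr (Or.inl ⟨⟨a, Or.inl b, d⟩,
      fun _ => Or.inr (Or.inr (Or.inr (Or.inr ⟨b, g⟩)))⟩)))
  · exact Or.inr (Or.inr (Or.inr (Or.inr ⟨⟨a, b, d, e⟩, fun _ => Or.inl g⟩)))
  · exact Or.inr (Or.inr (Or.inr (Or.inr ⟨⟨a, b, d, e⟩, fun _ => Or.inr g⟩)))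

/-- Adding a component: statistics before and after, the constant part of the cost of opening the
component, and the number of boxes that keeping control costs. -/
inductive Move (S K L t f : ℤ) : ℤ → ℤ → ℤ → ℤ → ℤ → ℤ → ℤ → Prop
  | c3 : Move S K L t f (S + 3) (K + 1) L (t + 1) f 1 2
  | cb (n : ℤ) (hn : 4 ≤ n) : Move S K L t f (S + n) (K + 1) L t f (n - 2) 2
  | l4 : Move S K L t f (S + 4) K (L + 1) t (f + 1) 0 4
  | l6 : Move S K L t f (S + 6) K (L + 1) t f 2 4
  | lb (n : ℤ) (hn : 8 ≤ n) (he : n % 2 = 0) : Move S K L t f (S + n) K (L + 1) t f (n - 4) 4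

/-- Adding a component whose opening is optimal afterwards; `c` is the controlled value of the
resulting position. -/
inductive Good (S K L t f s c : ℤ) : ℤ → ℤ → ℤ → ℤ → ℤ → ℤ → ℤ → Prop
  | l4a (hc : 2 ≤ c) : Good S K L t f s c (S + 4) K (L + 1) t (f + 1) 0 4
  | l4b (hc : c < 2) (hx : t = 0) : Good S K L t f s c (S + 4) K (L + 1) t (f + 1) 0 4
  | l4c (hc : c < 2) (hx : t = 1) (hS : S % 4 = 3) :
      Good S K L t f s c (S + 4) K (L + 1) t (f + 1) 0 4
  | l4d (hc : c < 2) (hx : 0 < t) (hy : -1 ≤ c) (hz : ¬ (K = 3 ∧ t = 3 ∧ L = 0)) :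
      Good S K L t f s c (S + 4) K (L + 1) t (f + 1) 0 4
  | l6a (hc : 2 ≤ c) (hf : f = 0) (hx : ¬ (K = 2 ∧ t = 2 ∧ L = 0)) :
      Good S K L t f s c (S + 6) K (L + 1) t f 2 4
  | l6b (hc : c < 2) (hf : f = 0) (hx : t = 0) : Good S K L t f s c (S + 6) K (L + 1) t f 2 4
  | c3a (hc : 2 ≤ c) (hf : f = 0) (hs : s = 0) (hx : ¬ (K = 0 ∧ 0 < L)) :
      Good S K L t f s c (S + 3) (K + 1) L (t + 1) f 1 2
  | c3b (hc : 2 ≤ c) (hf : f = 0) (hs : s = 1) (hK : K = 1) (ht : t = 1) (hL : L = 1) :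
      Good S K L t f s c (S + 3) (K + 1) L (t + 1) f 1 2
  | c3c (hc : c < 2) (hf : f = 0) (ht : t = 0) (hS : S % 4 = 0) :
      Good S K L t f s c (S + 3) (K + 1) L (t + 1) f 1 2
  | c3d (hc : c < 2) (hf : f = 0) (hS : t = 0 → S % 4 ≠ 0) :
      Good S K L t f s c (S + 3) (K + 1) L (t + 1) f 1 2
  | c3e (hc : c < -1) (hS : t = 0 → S % 4 ≠ 0) :
      Good S K L t f s c (S + 3) (K + 1) L (t + 1) f 1 2
  | c3f (hc : c < 2) (hK : K = 2) (ht : t = 2) (hL : L = 1) :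
      Good S K L t f s c (S + 3) (K + 1) L (t + 1) f 1 2
  | lba (n : ℤ) (hn : 8 ≤ n) (he : n % 2 = 0) (hc : 2 ≤ c) (hf : f = 0) (hs : s = 0)
      (ht : t = 0) : Good S K L t f s c (S + n) K (L + 1) t f (n - 4) 4
  | lbb (n : ℤ) (hn : 8 ≤ n) (he : n % 2 = 0) (hc : 2 ≤ c) (hf : f = 0) (hs : s = 0)
      (ht : t = 1) (hK : K = 1) : Good S K L t f s c (S + n) K (L + 1) t f (n - 4) 4
  | cb (n : ℤ) (hn : 4 ≤ n) (hf : f = 0) (hs : s = 0) (ht : t = 0) (hL : L = 0) :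
      Good S K L t f s c (S + n) (K + 1) L t f (n - 2) 2

set_option maxHeartbeats 0 in
/-- No component is better than claimed. -/
theorem W_le_move (S K L t f s S1 K1 L1 t1 f1 e d : ℤ) (h : StatInv S K L t f s)
    (hK1 : 0 ≤ K1) (hL1 : 0 ≤ L1) (hn1 : 0 < K1 + L1)
    (M : Move S K L t f S1 K1 L1 t1 f1 e d) :
    W S1 K1 L1 t1 f1 ≤ e + |W S K L t f - d| := by
  unfold StatInv at h
  obtain ⟨h1, h2, h3, h4, h5, h6, h7, h8⟩ := h
  replace h6 : 3 * t + 4 * (K - t) + 4 * f + 6 * (L - f) ≤ S := by clear h7 h8; omega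
  replace h8 : K = t → L = f → S = 3 * t + 4 * f := by clear h7; omega
  replace h5 : f ≤ L := by clear h6 h7 h8; omega
  clear h3 s
  have ha1 := le_abs_self (W S K L t f - d)
  have ha2 := neg_abs_le (W S K L t f - d)
  generalize |W S K L t f - d| = a at *
  rcases W_spec S1 K1 L1 t1 f1 hK1 hL1 with hw | ⟨-, c, hc, hw⟩
  · omega
  rw [hw]
  clear hw
  have T := tbI_cases K1 L1 t1 hK1 hL1
  have hW := fun _ : Unit => W0_nest c S1 K1 L1 t1 f1
  generalize W0 c S1 K1 L1 t1 f1 = w at *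
  generalize tbI K1 L1 t1 = b at *
  rcases W_spec S K L t f (by omega) (by omega) with ⟨hK', hL', hw'⟩ | ⟨hn, c', hc', hw'⟩
  · cases M <;>
    (rcases T with T | T | T | T | T <;> first | (exfalso; omega) |
      (rcases hW () with h | h | h | h | h <;> first | (exfalso; omega) |
        (have g := h.2 ()
         (try casesm* _ ∨ _) <;> omega)))
  have T' := tbI_cases K L t (by omega) (by omega)
  have hW' := fun _ : Unit => W0_nest c' S K L t f
  generalize W0 c' S K L t f = w' at *
  generalize tbI K L t = b' at *
  cases M <;>
  (rcases T with T | T | T | T | T <;> first | (exfalso; omega) |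
   (rcases T' with T' | T' | T' | T' | T' <;> first | (exfalso; omega) |
    (rcases hW () with h | h | h | h | h <;> first | (exfalso; omega) |
     (rcases hW' () with h' | h' | h' | h' | h' <;> first | (exfalso; omega) |
      (have g := h.2 ()
       have g' := h'.2 ()
       (try casesm* _ ∨ _) <;> omega)))))

set_option maxHeartbeats 0 in
/-- The claimed value is attained by good moves. -/
theorem W_eq_good (S K L t f s c S1 K1 L1 t1 f1 e d : ℤ) (h : StatInv S K L t f s)
    (hK1 : 0 ≤ K1) (hL1 : 0 ≤ L1) (hn1 : 0 < K1 + L1)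
    (hc : c = S1 - 4 * K1 - 8 * L1 + tbI K1 L1 t1) (M : Good S K L t f s c S1 K1 L1 t1 f1 e d) :
    W S1 K1 L1 t1 f1 = e + |W S K L t f - d| := by
  unfold StatInv at h
  obtain ⟨h1, h2, h3, h4, h5, h6, h7, h8⟩ := h
  have ha1 := abs_cases (W S K L t f - d)
  generalize |W S K L t f - d| = a at *
  rcases W_spec S1 K1 L1 t1 f1 hK1 hL1 with hw | ⟨-, c0, hc0, hw⟩
  · omega
  obtain rfl : c = c0 := hc.trans hc0.symm
  clear hc0
  rw [hw]
  clear hw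
  have T := tbI_cases K1 L1 t1 hK1 hL1
  have hW := fun _ : Unit => W0_nest c S1 K1 L1 t1 f1
  generalize W0 c S1 K1 L1 t1 f1 = w at *
  generalize tbI K1 L1 t1 = b at *
  rcases W_spec S K L t f (by omega) (by omega) with ⟨hK', hL', hw'⟩ | ⟨hn, c', hc', hw'⟩
  · cases M <;>
    (rcases T with T | T | T | T | T <;> first | (exfalso; clear ha1; omega) |
      (rcases hW () with h | h | h | h | h <;> first | (exfalso; clear ha1; omega) |
        (have g := h.2 ()
         (try casesm* _ ∨ _) <;> omega)))
  have T' := tbI_cases K L t (by omega) (by omega)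
  have hW' := fun _ : Unit => W0_nest c' S K L t f
  generalize W0 c' S K L t f = w' at *
  generalize tbI K L t = b' at *
  cases M <;>
  (rcases T with T | T | T | T | T <;> first | (exfalso; clear ha1; omega) |
   (rcases T' with T' | T' | T' | T' | T' <;> first | (exfalso; clear ha1; omega) |
    (rcases hW () with h | h | h | h | h <;> first | (exfalso; clear ha1; omega) |
     (rcases hW' () with h' | h' | h' | h' | h' <;> first | (exfalso; clear ha1; omega) |
      (have g := h.2 ()
       have g' := h'.2 ()
       (try casesm* _ ∨ _) <;> omega)))))

/-! ### Statistics of positions -/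

theorem size_cons (C : Component) (G : Position) : size (C ::ₘ G) = C.size + size G := by
  simp [size]

/-- The vector of statistics satisfies the constraints. -/
def GInv (G : Position) : Prop :=
  StatInv (size G) (numChains G) (numLoops G) (theta G) (numF G) (numS G)

theorem numChains_cons (C : Component) (G : Position) :
    numChains (C ::ₘ G) = numChains G + if C.isChain = true then 1 else 0 := by
  unfold numChains
  rw [Multiset.filter_cons]
  split_ifs <;> simp [add_comm]

theorem numLoops_cons (C : Component) (G : Position) :
    numLoops (C ::ₘ G) = numLoops G + if C.isLoop = true then 1 else 0 := by
  unfold numLoops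
  rw [Multiset.filter_cons]
  split_ifs <;> simp [add_comm]

theorem theta_cons (C : Component) (G : Position) :
    theta (C ::ₘ G) = theta G + if Component.chain 3 = C then 1 else 0 := by
  unfold theta; rw [Multiset.count_cons]

theorem numF_cons (C : Component) (G : Position) :
    numF (C ::ₘ G) = numF G + if Component.loop 4 = C then 1 else 0 := by
  unfold numF; rw [Multiset.count_cons]

theorem numS_cons (C : Component) (G : Position) :
    numS (C ::ₘ G) = numS G + if Component.loop 6 = C then 1 else 0 := by
  unfold numS; rw [Multiset.count_cons]

/-- The claimed value of a position. -/
def WG (G : Position) : ℤ := W (size G) (numChains G) (numLoops G) (theta G) (numF G)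

/-- Statistics after adding a component. -/
theorem stats_c3 (G : Position) :
    size (.chain 3 ::ₘ G) = size G + 3 ∧ numChains (.chain 3 ::ₘ G) = numChains G + 1 ∧
    numLoops (.chain 3 ::ₘ G) = numLoops G ∧ theta (.chain 3 ::ₘ G) = theta G + 1 ∧
    numF (.chain 3 ::ₘ G) = numF G ∧ numS (.chain 3 ::ₘ G) = numS G := by
  simp [size_cons, numChains_cons, numLoops_cons, theta_cons, numF_cons, numS_cons,
    Component.size, Component.isChain, Component.isLoop, add_comm]

theorem stats_cb (G : Position) (n : ℕ) (hn : 4 ≤ n) :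
    size (.chain n ::ₘ G) = size G + n ∧ numChains (.chain n ::ₘ G) = numChains G + 1 ∧
    numLoops (.chain n ::ₘ G) = numLoops G ∧ theta (.chain n ::ₘ G) = theta G ∧
    numF (.chain n ::ₘ G) = numF G ∧ numS (.chain n ::ₘ G) = numS G := by
  have h : ¬ (3 = n) := by omega
  simp [size_cons, numChains_cons, numLoops_cons, theta_cons, numF_cons, numS_cons,
    Component.size, Component.isChain, Component.isLoop, add_comm, h]

theorem stats_l4 (G : Position) :
    size (.loop 4 ::ₘ G) = size G + 4 ∧ numChains (.loop 4 ::ₘ G) = numChains G ∧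
    numLoops (.loop 4 ::ₘ G) = numLoops G + 1 ∧ theta (.loop 4 ::ₘ G) = theta G ∧
    numF (.loop 4 ::ₘ G) = numF G + 1 ∧ numS (.loop 4 ::ₘ G) = numS G := by
  simp [size_cons, numChains_cons, numLoops_cons, theta_cons, numF_cons, numS_cons,
    Component.size, Component.isChain, Component.isLoop, add_comm]

theorem stats_l6 (G : Position) :
    size (.loop 6 ::ₘ G) = size G + 6 ∧ numChains (.loop 6 ::ₘ G) = numChains G ∧
    numLoops (.loop 6 ::ₘ G) = numLoops G + 1 ∧ theta (.loop 6 ::ₘ G) = theta G ∧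
    numF (.loop 6 ::ₘ G) = numF G ∧ numS (.loop 6 ::ₘ G) = numS G + 1 := by
  simp [size_cons, numChains_cons, numLoops_cons, theta_cons, numF_cons, numS_cons,
    Component.size, Component.isChain, Component.isLoop, add_comm]

theorem stats_lb (G : Position) (n : ℕ) (hn : 8 ≤ n) :
    size (.loop n ::ₘ G) = size G + n ∧ numChains (.loop n ::ₘ G) = numChains G ∧
    numLoops (.loop n ::ₘ G) = numLoops G + 1 ∧ theta (.loop n ::ₘ G) = theta G ∧
    numF (.loop n ::ₘ G) = numF G ∧ numS (.loop n ::ₘ G) = numS G := by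
  have h : ¬ (4 = n) := by omega
  have h' : ¬ (6 = n) := by omega
  simp [size_cons, numChains_cons, numLoops_cons, theta_cons, numF_cons, numS_cons,
    Component.size, Component.isChain, Component.isLoop, add_comm, h, h']

/-- The five types of valid components. -/
theorem valid_cases (C : Component) (h : C.Valid) :
    C = .chain 3 ∨ (∃ n, 4 ≤ n ∧ C = .chain n) ∨ C = .loop 4 ∨ C = .loop 6 ∨
    (∃ n, 8 ≤ n ∧ n % 2 = 0 ∧ C = .loop n) := by
  cases C with
  | chain n =>
    have h : 3 ≤ n := h
    rcases Nat.lt_or_ge 3 n with h3 | h3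
    · exact Or.inr (Or.inl ⟨n, h3, rfl⟩)
    · left; congr 1; omega
  | loop n =>
    obtain ⟨h, he⟩ : 4 ≤ n ∧ Even n := h
    rw [Nat.even_iff] at he
    rcases Nat.lt_or_ge n 8 with h8 | h8
    · have : n = 4 ∨ n = 6 := by omega
      rcases this with rfl | rfl <;> simp
    · exact Or.inr (Or.inr (Or.inr (Or.inr ⟨n, h8, he, rfl⟩)))

theorem ginv_of_valid (G : Position) (hG : G.Valid) : GInv G := by
  induction G using Multiset.induction_on with
  | empty => simp [GInv, StatInv, size, numChains, numLoops, theta, numF, numS]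
  | cons C G ih =>
    have ih := ih (fun D hD => hG D (Multiset.mem_cons_of_mem hD))
    have hC := hG C (Multiset.mem_cons_self C G)
    unfold GInv StatInv at ih ⊢
    obtain ⟨h1, h2, h3, h4, h5, h6, h7, h8⟩ := ih
    rcases valid_cases C hC with rfl | ⟨n, hn, rfl⟩ | rfl | rfl | ⟨n, hn, hne, rfl⟩
    · obtain ⟨e1, e2, e3, e4, e5, e6⟩ := stats_c3 G
      rw [e1, e2, e3, e4, e5, e6]; push_cast
      and_intros <;> omega
    · obtain ⟨e1, e2, e3, e4, e5, e6⟩ := stats_cb G n hn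
      rw [e1, e2, e3, e4, e5, e6]; push_cast
      and_intros <;> omega
    · obtain ⟨e1, e2, e3, e4, e5, e6⟩ := stats_l4 G
      rw [e1, e2, e3, e4, e5, e6]; push_cast
      and_intros <;> omega
    · obtain ⟨e1, e2, e3, e4, e5, e6⟩ := stats_l6 G
      rw [e1, e2, e3, e4, e5, e6]; push_cast
      and_intros <;> omega
    · obtain ⟨e1, e2, e3, e4, e5, e6⟩ := stats_lb G n hn
      rw [e1, e2, e3, e4, e5, e6]; push_cast
      and_intros <;> omega

/-! ### The recursion -/

theorem openVal_ge (C : Component) (w : ℤ) : -4 ≤ openVal C w := by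
  cases C with
  | chain n => have := abs_nonneg (w - 2); simp only [openVal]; omega
  | loop n => have := abs_nonneg (w - 4); simp only [openVal]; omega

theorem value_zero : value 0 = 0 := by simp [value, valueAux]

theorem value_eq (G : Position) (hne : G ≠ 0) :
    value G = sInf { x : ℤ | ∃ C ∈ G, x = openVal C (value (G.erase C)) } := by
  have hc : 0 < Multiset.card G := Multiset.card_pos.mpr hne
  obtain ⟨m, hm⟩ : ∃ m, Multiset.card G = m + 1 := ⟨Multiset.card G - 1, by omega⟩
  conv_lhs => unfold value
  rw [hm, valueAux, if_neg hne]
  congr 1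
  ext x
  simp only [Set.mem_ofPred_eq]
  refine exists_congr fun C => and_congr_right fun hC => ?_
  unfold value
  rw [Multiset.card_erase_of_mem hC, hm]
  rfl

theorem value_le (G : Position) (C : Component) (hC : C ∈ G) :
    value G ≤ openVal C (value (G.erase C)) := by
  have hne : G ≠ 0 := fun h => by simp [h] at hC
  rw [value_eq G hne]
  refine csInf_le ⟨-4, ?_⟩ ⟨C, hC, rfl⟩
  rintro x ⟨D, -, rfl⟩
  exact openVal_ge _ _

theorem value_attained (G : Position) (hne : G ≠ 0) :
    ∃ C ∈ G, value G = openVal C (value (G.erase C)) := by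
  obtain ⟨C, hC⟩ := Multiset.exists_mem_of_ne_zero hne
  have := Int.csInf_mem (s := { x : ℤ | ∃ C ∈ G, x = openVal C (value (G.erase C)) })
    ⟨_, C, hC, rfl⟩ ⟨-4, by rintro x ⟨D, -, rfl⟩; exact openVal_ge _ _⟩
  rw [← value_eq G hne] at this
  exact this

theorem WG_zero : WG 0 = 0 := by
  simp [WG, W, numChains, numLoops]

/-- The lower bound for one move. -/
theorem WG_le (G : Position) (hG : G.Valid) (C : Component) (hC : C.Valid) :
    WG (C ::ₘ G) ≤ openVal C (WG G) := by
  have hI := ginv_of_valid G hG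
  unfold GInv at hI
  unfold WG
  rcases valid_cases C hC with rfl | ⟨n, hn, rfl⟩ | rfl | rfl | ⟨n, hn, hne, rfl⟩
  · obtain ⟨e1, e2, e3, e4, e5, e6⟩ := stats_c3 G
    rw [e1, e2, e3, e4, e5]
    have := W_le_move _ _ _ _ _ _ _ _ _ _ _ _ _ hI (by omega) (by omega) (by omega) .c3
    simpa [openVal] using this
  · obtain ⟨e1, e2, e3, e4, e5, e6⟩ := stats_cb G n hn
    rw [e1, e2, e3, e4, e5]
    have := W_le_move _ _ _ _ _ _ _ _ _ _ _ _ _ hI (by omega) (by omega) (by omega)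
      (.cb (n : ℤ) (by omega))
    simpa [openVal] using this
  · obtain ⟨e1, e2, e3, e4, e5, e6⟩ := stats_l4 G
    rw [e1, e2, e3, e4, e5]
    have := W_le_move _ _ _ _ _ _ _ _ _ _ _ _ _ hI (by omega) (by omega) (by omega) .l4
    simpa [openVal] using this
  · obtain ⟨e1, e2, e3, e4, e5, e6⟩ := stats_l6 G
    rw [e1, e2, e3, e4, e5]
    have := W_le_move _ _ _ _ _ _ _ _ _ _ _ _ _ hI (by omega) (by omega) (by omega) .l6
    simpa [openVal] using this
  · obtain ⟨e1, e2, e3, e4, e5, e6⟩ := stats_lb G n hn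
    rw [e1, e2, e3, e4, e5]
    have := W_le_move _ _ _ _ _ _ _ _ _ _ _ _ _ hI (by omega) (by omega) (by omega)
      (.lb (n : ℤ) (by omega) (by omega))
    simpa [openVal] using this

theorem exists_chain (G : Position) (hG : G.Valid) (h : theta G < numChains G) :
    ∃ n, 4 ≤ n ∧ Component.chain n ∈ G := by
  by_contra hno
  push Not at hno
  have key : ∀ H : Position, H ≤ G → numChains H ≤ theta H := by
    intro H
    induction H using Multiset.induction_on with
    | empty => simp [numChains]
    | cons C H ih =>
      intro hle
      have ih := ih ((Multiset.le_cons_self H C).trans hle)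
      have hC : C ∈ G := Multiset.mem_of_le hle (Multiset.mem_cons_self C H)
      rw [numChains_cons, theta_cons]
      rcases valid_cases C (hG C hC) with rfl | ⟨n, hn, rfl⟩ | rfl | rfl | ⟨n, hn, hne, rfl⟩
      · simpa [Component.isChain] using ih
      · exact absurd hC (hno n hn)
      · simpa [Component.isChain] using ih
      · simpa [Component.isChain] using ih
      · simpa [Component.isChain] using ih
  have := key G le_rfl
  omega

theorem exists_loop (G : Position) (hG : G.Valid) (h : numF G + numS G < numLoops G) :
    ∃ n, 8 ≤ n ∧ n % 2 = 0 ∧ Component.loop n ∈ G := by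
  by_contra hno
  push Not at hno
  have key : ∀ H : Position, H ≤ G → numLoops H ≤ numF H + numS H := by
    intro H
    induction H using Multiset.induction_on with
    | empty => simp [numLoops]
    | cons C H ih =>
      intro hle
      have ih := ih ((Multiset.le_cons_self H C).trans hle)
      have hC : C ∈ G := Multiset.mem_of_le hle (Multiset.mem_cons_self C H)
      rw [numLoops_cons, numF_cons, numS_cons]
      rcases valid_cases C (hG C hC) with rfl | ⟨n, hn, rfl⟩ | rfl | rfl | ⟨n, hn, hne, rfl⟩
      · simpa [Component.isLoop] using ih
      · simpa [Component.isLoop] using ih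
      · simp [Component.isLoop]; omega
      · simp [Component.isLoop]; omega
      · exact absurd hC (hno n hn hne)
  have := key G le_rfl
  omega

theorem numC_pos (G : Position) (hne : G ≠ 0) : 0 < numChains G + numLoops G := by
  obtain ⟨C, hC⟩ := Multiset.exists_mem_of_ne_zero hne
  obtain ⟨H, rfl⟩ := Multiset.exists_cons_of_mem hC
  rw [numChains_cons, numLoops_cons]
  cases C <;> simp [Component.isChain, Component.isLoop]

/-- Some move attains the claimed value. -/
theorem WG_attained (G : Position) (hG : G.Valid) (hne : G ≠ 0) :
    ∃ C ∈ G, WG G = openVal C (WG (G.erase C)) := by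
  have hI := ginv_of_valid G hG
  have hpos := numC_pos G hne
  have hsub : ∀ C, Position.Valid (G.erase C) := fun C D hD => hG D (Multiset.mem_of_mem_erase hD)
  -- the controlled value
  obtain ⟨c, hc⟩ : ∃ c : ℤ, c = (size G : ℤ) - 4 * numChains G - 8 * numLoops G +
    tbI (numChains G) (numLoops G) (theta G) := ⟨_, rfl⟩
  have mv4 : 0 < numF G → (2 ≤ c ∨ (c < 2 ∧ (theta G = 0 ∨ (theta G = 1 ∧ size G % 4 = 3))) ∨
      (c < 2 ∧ 0 < theta G ∧ -1 ≤ c ∧ ¬ (numChains G = 3 ∧ theta G = 3 ∧ numLoops G = 1))) →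
      ∃ C ∈ G, WG G = openVal C (WG (G.erase C)) := by
    intro hf hcase
    have hm : Component.loop 4 ∈ G := Multiset.count_pos.mp hf
    refine ⟨_, hm, ?_⟩
    obtain ⟨e1, e2, e3, e4, e5, e6⟩ := stats_l4 (G.erase (.loop 4))
    have hJ := ginv_of_valid _ (hsub (.loop 4))
    rw [Multiset.cons_erase hm] at e1 e2 e3 e4 e5 e6
    unfold GInv at hJ
    unfold WG
    rw [e1, e2, e3, e4] at hc
    rw [e1, e2, e3, e4, e5]
    push_cast at hc ⊢
    simp only [openVal]
    rcases hcase with h | ⟨h, h'⟩ | ⟨h, h1, h2, h3⟩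
    · have := W_eq_good _ _ _ _ _ _ _ _ _ _ _ _ _ _ hJ (by omega) (by omega) (by omega)
          hc (.l4a h)
      rw [this]; norm_num
    · rcases h' with h' | ⟨h', h1⟩
      · have := W_eq_good _ _ _ _ _ _ _ _ _ _ _ _ _ _ hJ (by omega) (by omega) (by omega)
          hc (.l4b h (by omega))
        rw [this]; norm_num
      · have := W_eq_good _ _ _ _ _ _ _ _ _ _ _ _ _ _ hJ (by omega) (by omega) (by omega)
          hc (.l4c h (by omega) (by omega))
        rw [this]; norm_num
    · have := W_eq_good _ _ _ _ _ _ _ _ _ _ _ _ _ _ hJ (by omega) (by omega) (by omega)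
          hc (.l4d h (by omega) h2 (by omega))
      rw [this]; norm_num
  have mv6 : numF G = 0 → 0 < numS G → ((2 ≤ c ∧
      ¬ (numChains G = 2 ∧ theta G = 2 ∧ numLoops G = 1)) ∨ (c < 2 ∧ theta G = 0)) →
      ∃ C ∈ G, WG G = openVal C (WG (G.erase C)) := by
    intro hf hs hcase
    have hm : Component.loop 6 ∈ G := Multiset.count_pos.mp hs
    refine ⟨_, hm, ?_⟩
    obtain ⟨e1, e2, e3, e4, e5, e6⟩ := stats_l6 (G.erase (.loop 6))
    have hJ := ginv_of_valid _ (hsub (.loop 6))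
    rw [Multiset.cons_erase hm] at e1 e2 e3 e4 e5 e6
    unfold GInv at hJ
    unfold WG
    rw [e1, e2, e3, e4] at hc
    rw [e1, e2, e3, e4, e5]
    push_cast at hc ⊢
    simp only [openVal]
    rcases hcase with ⟨h, h'⟩ | ⟨h, h'⟩
    · have := W_eq_good _ _ _ _ _ _ _ _ _ _ _ _ _ _ hJ (by omega) (by omega) (by omega)
          hc (.l6a h (by omega) (by omega))
      rw [this]; norm_num
    · have := W_eq_good _ _ _ _ _ _ _ _ _ _ _ _ _ _ hJ (by omega) (by omega) (by omega)
          hc (.l6b h (by omega) (by omega))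
      rw [this]; norm_num
  have mv3 : 0 < theta G →
      ((2 ≤ c ∧ numF G = 0 ∧ ((numS G = 0 ∧ ¬ (numChains G = 1 ∧ 0 < numLoops G)) ∨
        (numChains G = 2 ∧ theta G = 2 ∧ numLoops G = 1 ∧ numS G = 1))) ∨
      (c < 2 ∧ numF G = 0 ∧ theta G = 1 ∧ size G % 4 = 3) ∨
      (c < 2 ∧ (numF G = 0 ∨ c < -1 ∨ (numChains G = 3 ∧ theta G = 3 ∧ numLoops G = 1)) ∧
        (theta G = 1 → size G % 4 ≠ 3))) →
      ∃ C ∈ G, WG G = openVal C (WG (G.erase C)) := by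
    intro ht hcase
    have hm : Component.chain 3 ∈ G := Multiset.count_pos.mp ht
    refine ⟨_, hm, ?_⟩
    obtain ⟨e1, e2, e3, e4, e5, e6⟩ := stats_c3 (G.erase (.chain 3))
    have hJ := ginv_of_valid _ (hsub (.chain 3))
    rw [Multiset.cons_erase hm] at e1 e2 e3 e4 e5 e6
    unfold GInv at hJ
    unfold WG
    rw [e1, e2, e3, e4] at hc
    rw [e1, e2, e3, e4, e5]
    push_cast at hc ⊢
    simp only [openVal]
    rcases hcase with ⟨h, h', h2⟩ | ⟨h, h', h2, h3⟩ | ⟨h, h', h2⟩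
    · rcases h2 with h2 | h2
      · have := W_eq_good _ _ _ _ _ _ _ _ _ _ _ _ _ _ hJ (by omega) (by omega) (by omega)
          hc (.c3a h (by omega) (by omega) (by omega))
        rw [this]; norm_num
      · have := W_eq_good _ _ _ _ _ _ _ _ _ _ _ _ _ _ hJ (by omega) (by omega) (by omega)
          hc (.c3b h (by omega) (by omega) (by omega) (by omega) (by omega))
        rw [this]; norm_num
    · have := W_eq_good _ _ _ _ _ _ _ _ _ _ _ _ _ _ hJ (by omega) (by omega) (by omega)
          hc (.c3c h (by omega) (by omega) (by omega))
      rw [this]; norm_num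
    · rcases h' with h' | h' | h'
      · have := W_eq_good _ _ _ _ _ _ _ _ _ _ _ _ _ _ hJ (by omega) (by omega) (by omega)
          hc (.c3d h (by omega) (by omega))
        rw [this]; norm_num
      · have := W_eq_good _ _ _ _ _ _ _ _ _ _ _ _ _ _ hJ (by omega) (by omega) (by omega)
          hc (.c3e h' (by omega))
        rw [this]; norm_num
      · have := W_eq_good _ _ _ _ _ _ _ _ _ _ _ _ _ _ hJ (by omega) (by omega) (by omega)
          hc (.c3f h (by omega) (by omega) (by omega))
        rw [this]; norm_num
  have mvl : numF G = 0 → numS G = 0 → 0 < numLoops G → 2 ≤ c →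
      (theta G = 0 ∨ (theta G = 1 ∧ numChains G = 1)) →
      ∃ C ∈ G, WG G = openVal C (WG (G.erase C)) := by
    intro hf hs hl h hcase
    obtain ⟨n, hn, hne, hm⟩ := exists_loop G hG (by omega)
    refine ⟨_, hm, ?_⟩
    obtain ⟨e1, e2, e3, e4, e5, e6⟩ := stats_lb (G.erase (.loop n)) n hn
    have hJ := ginv_of_valid _ (hsub (.loop n))
    rw [Multiset.cons_erase hm] at e1 e2 e3 e4 e5 e6
    unfold GInv at hJ
    unfold WG
    rw [e1, e2, e3, e4] at hc
    rw [e1, e2, e3, e4, e5]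
    push_cast at hc ⊢
    simp only [openVal]
    rcases hcase with ht | ht
    · have := W_eq_good _ _ _ _ _ _ _ _ _ _ _ _ _ _ hJ (by omega) (by omega) (by omega)
          hc (.lba (n : ℤ) (by omega) (by omega) h (by omega) (by omega) (by omega))
      rw [this]
    · have := W_eq_good _ _ _ _ _ _ _ _ _ _ _ _ _ _ hJ (by omega) (by omega) (by omega)
          hc (.lbb (n : ℤ) (by omega) (by omega) h (by omega) (by omega) (by omega) (by omega))
      rw [this]
  have mvc : numF G = 0 → numS G = 0 → numLoops G = 0 → theta G = 0 →
      ∃ C ∈ G, WG G = openVal C (WG (G.erase C)) := by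
    intro hf hs hl ht
    obtain ⟨n, hn, hm⟩ := exists_chain G hG (by omega)
    refine ⟨_, hm, ?_⟩
    obtain ⟨e1, e2, e3, e4, e5, e6⟩ := stats_cb (G.erase (.chain n)) n hn
    have hJ := ginv_of_valid _ (hsub (.chain n))
    rw [Multiset.cons_erase hm] at e1 e2 e3 e4 e5 e6
    unfold GInv at hJ
    unfold WG
    rw [e1, e2, e3, e4] at hc
    rw [e1, e2, e3, e4, e5]
    push_cast at hc ⊢
    simp only [openVal]
    have := W_eq_good _ _ _ _ _ _ _ _ _ _ _ _ _ _ hJ (by omega) (by omega) (by omega)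
          hc (.cb (n : ℤ) (by omega) (by omega) (by omega) (by omega) (by omega))
    rw [this]
  have T := tbI_cases (numChains G) (numLoops G) (theta G) (by omega) (by omega)
  unfold GInv StatInv at hI
  obtain ⟨h1, h2, h3, h4, h5, h6, h7, h8⟩ := hI
  have hbig : c < 2 → theta G = 0 → numF G = 0 → 0 < numS G := by
    clear mv4 mv6 mv3 mvl mvc
    omega
  clear h7 h8 h6 hc T
  by_cases hc2 : 2 ≤ c
  · by_cases hf : 0 < numF G
    · exact mv4 hf (Or.inl hc2)
    have hf : numF G = 0 := by omega
    by_cases hs : 0 < numS G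
    · by_cases hx : numChains G = 2 ∧ theta G = 2 ∧ numLoops G = 1
      · exact mv3 (by omega) (Or.inl ⟨hc2, hf, Or.inr ⟨hx.1, hx.2.1, hx.2.2, by omega⟩⟩)
      · exact mv6 hf hs (Or.inl ⟨hc2, hx⟩)
    have hs : numS G = 0 := by omega
    by_cases ht : theta G = 0
    · by_cases hl : numLoops G = 0
      · exact mvc hf hs hl ht
      · exact mvl hf hs (by omega) hc2 (Or.inl ht)
    by_cases hx : numChains G = 1 ∧ 0 < numLoops G
    · exact mvl hf hs hx.2 hc2 (Or.inr ⟨by omega, hx.1⟩)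
    · exact mv3 (by omega) (Or.inl ⟨hc2, hf, Or.inl ⟨hs, hx⟩⟩)
  · have hc2 : c < 2 := by omega
    by_cases h3 : theta G = 0 ∨ (theta G = 1 ∧ size G % 4 = 3)
    · by_cases hf : 0 < numF G
      · exact mv4 hf (Or.inr (Or.inl ⟨hc2, h3⟩))
      have hf : numF G = 0 := by omega
      rcases h3 with h3 | h3
      · exact mv6 hf (hbig hc2 h3 hf) (Or.inr ⟨hc2, h3⟩)
      · exact mv3 (by omega) (Or.inr (Or.inl ⟨hc2, hf, h3⟩))
    by_cases hx : 0 < numF G ∧ -1 ≤ c ∧ ¬ (numChains G = 3 ∧ theta G = 3 ∧ numLoops G = 1)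
    · exact mv4 hx.1 (Or.inr (Or.inr ⟨hc2, by omega, hx.2⟩))
    · refine mv3 (by omega) (Or.inr (Or.inr ⟨hc2, ?_, fun a b => h3 (Or.inr ⟨a, b⟩)⟩))
      omega

theorem value_eq_WG : ∀ (n : ℕ) (G : Position), Multiset.card G = n → G.Valid → value G = WG G := by
  intro n
  induction n with
  | zero =>
    intro G hn _
    rw [Multiset.card_eq_zero] at hn
    rw [hn, value_zero, WG_zero]
  | succ n ih =>
    intro G hn hG
    have hne : G ≠ 0 := fun h => by simp [h] at hn
    have hsub : ∀ C, Position.Valid (G.erase C) :=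
      fun C D hD => hG D (Multiset.mem_of_mem_erase hD)
    have ih' : ∀ C ∈ G, value (G.erase C) = WG (G.erase C) := fun C hC =>
      ih _ (by rw [Multiset.card_erase_of_mem hC, hn]; rfl) (hsub C)
    apply le_antisymm
    · obtain ⟨C, hC, h⟩ := WG_attained G hG hne
      rw [h, ← ih' C hC]
      exact value_le G C hC
    · obtain ⟨C, hC, h⟩ := value_attained G hne
      rw [h, ih' C hC]
      have := WG_le _ (hsub C) C (hG C hC)
      rwa [Multiset.cons_erase hC] at this

theorem tb_eq (G : Position) (hG : G.Valid) :
    tb G = tbI (numChains G) (numLoops G) (theta G) := by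
  have hK : numChains G = 0 ↔ ∀ C ∈ G, C.isLoop = true := by
    unfold numChains
    rw [Multiset.card_eq_zero, Multiset.filter_eq_nil]
    refine forall₂_congr fun C _ => ?_
    cases C <;> simp [Component.isChain, Component.isLoop]
  have hL : 0 < numLoops G ↔ ∃ C ∈ G, C.isLoop = true := by
    unfold numLoops
    rw [Multiset.card_pos_iff_exists_mem]
    simp
  have ht : 0 < theta G ↔ Component.chain 3 ∈ G := Multiset.count_pos
  have hKt : numChains G = theta G ↔ ∀ C ∈ G, C.isChain = true → C = Component.chain 3 := by
    unfold numChains theta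
    rw [Multiset.count_eq_card_filter_eq]
    have hle : G.filter (fun C => Component.chain 3 = C) ≤ G.filter (fun C => C.isChain = true) := by
      apply Multiset.monotone_filter_right
      rintro C rfl
      rfl
    constructor
    · intro h C hC hc
      have heq := Multiset.eq_of_le_of_card_le hle h.le
      have hm : C ∈ G.filter (fun C => C.isChain = true) := Multiset.mem_filter.mpr ⟨hC, hc⟩
      rw [← heq] at hm
      exact (Multiset.mem_filter.mp hm).2.symm
    · intro h
      congr 1
      apply Multiset.filter_congr
      intro C hC
      constructor
      · intro hc; exact (h C hC hc).symm
      · rintro rfl; rfl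
  have hI := ginv_of_valid G hG
  unfold GInv StatInv at hI
  by_cases h0 : G = 0
  · subst h0
    simp [tb, tbI, numChains, numLoops]
  have hpos := numC_pos G h0
  unfold tb tbI
  rw [if_neg h0]
  simp only [← hK, ← hL, ← ht, ← hKt]
  obtain ⟨h1, h2, h3, h4, h5, -⟩ := hI
  split_ifs <;> omega

theorem exc_iff (G : Position) (hG : G.Valid) :
    G = Component.loop 4 ::ₘ Component.chain 3 ::ₘ {Component.chain 3} ↔
    ((size G : ℤ) = 10 ∧ (numChains G : ℤ) = 2 ∧ (numLoops G : ℤ) = 1 ∧ (theta G : ℤ) = 2 ∧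
      (numF G : ℤ) = 1) := by
  constructor
  · rintro rfl
    refine ⟨?_, ?_, ?_, ?_, ?_⟩ <;> rfl
  · rintro ⟨-, h2, h3, h4, h5⟩
    have hcard : Multiset.card G = numChains G + numLoops G := by
      clear hG h2 h3 h4 h5
      induction G using Multiset.induction_on with
      | empty => rfl
      | cons C G ih =>
        rw [Multiset.card_cons, numChains_cons, numLoops_cons, ih]
        cases C <;> simp [Component.isChain, Component.isLoop] <;> omega
    symm
    apply Multiset.eq_of_le_of_card_le
    · rw [Multiset.le_iff_count]
      intro C
      unfold theta at h4
      unfold numF at h5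
      by_cases e1 : C = Component.loop 4
      · subst e1
        have : Multiset.count (Component.loop 4)
          (Component.loop 4 ::ₘ Component.chain 3 ::ₘ {Component.chain 3}) = 1 := by rfl
        rw [this]; omega
      by_cases e2 : C = Component.chain 3
      · subst e2
        have : Multiset.count (Component.chain 3)
          (Component.loop 4 ::ₘ Component.chain 3 ::ₘ {Component.chain 3}) = 2 := by rfl
        rw [this]; omega
      · rw [Multiset.count_eq_zero_of_notMem]
        · omega
        · simp [e1, e2]
    · have : Multiset.card (Component.loop 4 ::ₘ Component.chain 3 ::ₘ {Component.chain 3}) = 3 := rfl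
      omega

theorem value_eq_W0 (G : Position) (hG : G.Valid) (hne : G ≠ 0) :
    value G = W0 (cval G) (size G) (numChains G) (numLoops G) (theta G) (numF G) := by
  rw [value_eq_WG _ G rfl hG]
  have hpos := numC_pos G hne
  unfold WG W cval
  rw [if_neg (by omega), tb_eq G hG]

/-- Explicit values: v(G) is given by the first of cases (1)-(4) that applies. -/
theorem values_explicit (G : Position) (hG : G.Valid) (hne : G ≠ 0) :
    (ValCase1 G → value G = cval G) ∧
    (¬ ValCase1 G → ValCase2 G → value G = 0) ∧
    (¬ ValCase1 G → ¬ ValCase2 G → ValCase3 G →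
      (2 ≤ cval G + 4 * (numF G : ℤ) →
        (cval G % 8 = 0 → value G = 0) ∧
        (cval G % 8 = 1 ∨ cval G % 8 = 7 → value G = 1) ∧
        (cval G % 8 = 2 ∨ cval G % 8 = 6 → value G = 2) ∧
        (cval G % 8 = 3 ∨ cval G % 8 = 5 → value G = 3) ∧
        (cval G % 8 = 4 → value G = 4)) ∧
      (cval G + 4 * (numF G : ℤ) < 2 →
        (Odd (size G) → (Odd (numF G) → value G = 1) ∧ (Even (numF G) → value G = 3)) ∧
        (size G % 4 = 2 → value G = 2) ∧
        (size G % 4 = 0 → (Odd (numF G) → value G = 0) ∧ (Even (numF G) → value G = 4)))) ∧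
    (¬ ValCase1 G → ¬ ValCase2 G → ¬ ValCase3 G →
      (Odd (size G) → value G = 1) ∧ (Even (size G) → value G = 2)) := by
  have hv := value_eq_W0 G hG hne
  have hx := exc_iff G hG
  have hf : Component.loop 4 ∈ G ↔ 0 < numF G := Multiset.count_pos.symm
  unfold ValCase1 ValCase2 ValCase3
  rw [Ne, hx, hf]
  generalize value G = w at *
  generalize cval G = c at *
  clear hx hf hG hne
  refine ⟨?_, ?_, ?_, ?_⟩
  · intro h1
    rw [hv]; unfold W0; rw [if_pos h1]
  · rintro h1 ⟨h2, h3, h4⟩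
    rw [hv]; unfold W0; rw [if_neg h1, if_pos ⟨h2, by omega, h4⟩]
  · intro h1 h2 h3
    unfold W0 at hv
    rw [if_neg h1, if_neg (fun h => h2 ⟨h.1, by omega, h.2.2⟩), if_pos (by omega)] at hv
    clear h2
    constructor
    · intro h4
      rw [if_pos h4] at hv
      split_ifs at hv <;> (and_intros <;> intro h5 <;> omega)
    · intro h4
      rw [if_neg (by omega)] at hv
      simp only [Nat.odd_iff, Nat.even_iff]
      split_ifs at hv <;> (and_intros <;> intro h5 <;> omega)
  · intro h1 h2 h3
    unfold W0 at hv
    rw [if_neg h1, if_neg (fun h => h2 ⟨h.1, by omega, h.2.2⟩), if_neg (by omega)] at hv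
    clear h2
    simp only [Nat.odd_iff, Nat.even_iff]
    split_ifs at hv <;> (and_intros <;> intro h5 <;> omega)

end DotsAndBoxes
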